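/- arXiv:0706.3397 — 4 statements merged into one kernel-verified Lean document; each statement's English description precedes it below -/
import Mathlib

section
/- Let n ≥ 3 be an integer and let μ be a real number with 0 < μ < n²(n+1)/2. Then in no complex inner product space do there exist vectors v and w with ⟨v, v⟩ = 2nμ, ⟨v, w⟩ = 2n³μ, and ⟨w, w⟩ = 2n²μ² + n⁴(n−1)μ. -/
theorem rhpwn_nogo_no_vectors (n : ℕ) (hn : 3 ≤ n) (μ : ℝ) (hμ0 : 0 < μ)
    (hμ : μ < n ^ 2 * (n + 1) / 2) :
    ∀ (V : Type*) [NormedAddCommGroup V] [InnerProductSpace ℂ V] (v w : V),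
      ¬ (inner ℂ v v = ((2 * n * μ : ℝ) : ℂ) ∧
         inner ℂ v w = ((2 * n ^ 3 * μ : ℝ) : ℂ) ∧
         inner ℂ w w = ((2 * n ^ 2 * μ ^ 2 + n ^ 4 * (n - 1) * μ : ℝ) : ℂ)) := by
  rintro V _ _ v w ⟨hvv, hvw, hww⟩
  have hn0 : (0 : ℝ) < n := by
    exact_mod_cast (by omega : 0 < n)
  have cauchy_schwarz := inner_mul_inner_self_le (𝕜 := ℂ) v w
  rw [norm_inner_symm w v, hvw, hvv, hww, Complex.norm_real, Real.norm_eq_abs,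
    abs_mul_abs_self] at cauchy_schwarz
  simp only [RCLike.re_to_complex, Complex.ofReal_re] at cauchy_schwarz
  have hpos : 0 < 4 * (n : ℝ) ^ 3 * μ ^ 2 * (n ^ 2 * (n + 1) / 2 - μ) :=
    mul_pos (by positivity) (sub_pos.mpr hμ)
  linarith
end

section
/- Let V be a complex inner product space, Φ ∈ V with ‖Φ‖ = 1, n ≥ 1 an integer, μ > 0 a real number, and let B⁺, B⁻, N be linear endomorphisms of V such that: ⟨B⁺u, v⟩ = ⟨u, B⁻v⟩ for all u, v ∈ V; B⁻Φ = 0; B⁻∘B⁺ − B⁺∘B⁻ = n²·N; and N((B⁺)ᵏΦ) = (μ/n + k·n·(n−1))·(B⁺)ᵏΦ for every integer k ≥ 0. Then for every integer k ≥ 0, ⟨(B⁺)ᵏΦ, (B⁺)ᵏΦ⟩ = k! · nᵏ · ∏_{i=0}^{k−1} (μ + (n²(n−1)/2)·i). -/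
/-- The annihilation operator lowers the `(k + 1)`-particle vector to a multiple of the
`k`-particle vector. -/
theorem annihilation_creation_pow {V : Type*} [AddCommGroup V] [Module ℂ V] {Φ : V}
    {n : ℕ} (hn : n ≠ 0) {μ : ℝ} {Bp Bm N : Module.End ℂ V} (h0 : Bm Φ = 0)
    (hcomm : Bm * Bp - Bp * Bm = ((n : ℂ) ^ 2) • N)
    (hN : ∀ k : ℕ, N ((Bp ^ k) Φ) = ((μ / n + k * n * (n - 1) : ℝ) : ℂ) • (Bp ^ k) Φ) (k : ℕ) :
    Bm ((Bp ^ (k + 1)) Φ) =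
      (((k + 1) * n * (μ + n ^ 2 * (n - 1) / 2 * k) : ℝ) : ℂ) • (Bp ^ k) Φ := by
  have hn' : (n : ℂ) ≠ 0 := Nat.cast_ne_zero.mpr hn
  have hswap (v : V) : Bm (Bp v) = Bp (Bm v) + ((n : ℂ) ^ 2) • N v := by
    have h := LinearMap.congr_fun hcomm v
    simp only [LinearMap.sub_apply, Module.End.mul_apply, LinearMap.smul_apply] at h
    rw [← h, add_sub_cancel]
  induction k with
  | zero =>
    rw [pow_succ', Module.End.mul_apply, hswap, hN, smul_smul]
    simp only [pow_zero, Module.End.one_apply, h0, map_zero, zero_add]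
    congr 1
    push_cast
    field_simp
    ring
  | succ k ih =>
    rw [pow_succ', Module.End.mul_apply, hswap, ih, hN, map_smul, ← Module.End.mul_apply,
      ← pow_succ', smul_smul, ← add_smul]
    congr 1
    push_cast
    field_simp
    ring

theorem trhpwn_fock_kernel (V : Type*) [NormedAddCommGroup V] [InnerProductSpace ℂ V] (Φ : V)
    (hΦ : ‖Φ‖ = 1) (n : ℕ) (hn : 1 ≤ n) (μ : ℝ) (hμ : 0 < μ)
    (Bp Bm N : Module.End ℂ V)
    (hadj : ∀ u v : V, (inner ℂ (Bp u) v : ℂ) = inner ℂ u (Bm v))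
    (h0 : Bm Φ = 0)
    (hcomm : Bm * Bp - Bp * Bm = ((n : ℂ) ^ 2) • N)
    (hN : ∀ k : ℕ, N ((Bp ^ k) Φ) = ((μ / n + k * n * (n - 1) : ℝ) : ℂ) • (Bp ^ k) Φ) :
    ∀ k : ℕ, (inner ℂ ((Bp ^ k) Φ) ((Bp ^ k) Φ) : ℂ) =
      ((k.factorial * n ^ k *
        ∏ i ∈ Finset.range k, (μ + n ^ 2 * (n - 1) / 2 * i) : ℝ) : ℂ) := by
  intro k
  induction k with
  | zero => simp [inner_self_eq_norm_sq_to_K, hΦ]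
  | succ k ih =>
    have hstep : (inner ℂ ((Bp ^ (k + 1)) Φ) ((Bp ^ (k + 1)) Φ) : ℂ) =
        inner ℂ ((Bp ^ k) Φ) (Bm ((Bp ^ (k + 1)) Φ)) := by
      rw [← hadj, ← Module.End.mul_apply, ← pow_succ']
    rw [hstep, annihilation_creation_pow (Nat.one_le_iff_ne_zero.mp hn) h0 hcomm hN,
      inner_smul_right, ih, Finset.prod_range_succ, Nat.factorial_succ]
    push_cast
    ring
end

section
/- Let V be a complex inner product space, Φ ∈ V, n ≥ 1 an integer, μ > 0 a real number, and let B⁺, B⁻, N be linear endomorphisms of V such that: ⟨B⁺u, v⟩ = ⟨u, B⁻v⟩ for all u, v ∈ V; B⁻Φ = 0; B⁻∘B⁺ − B⁺∘B⁻ = n²·N; and N((B⁺)ᵏΦ) = (μ/n + k·n·(n−1))·(B⁺)ᵏΦ for every integer k ≥ 0. Then for all integers k ≠ m with k, m ≥ 0, ⟨(B⁺)ᵏΦ, (B⁺)ᵐΦ⟩ = 0. -/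
/-- If `Bm * Bp - Bp * Bm` is diagonal on the vectors `(Bp ^ k) Φ` and `Bm` kills `Φ`, then `Bm`
lowers `(Bp ^ (k + 1)) Φ` to a multiple of `(Bp ^ k) Φ`. -/
theorem exists_annihilation_apply_pow_succ {R M : Type*} [CommRing R] [AddCommGroup M]
    [Module R M] {Bp Bm : Module.End R M} {Φ : M} (h0 : Bm Φ = 0)
    (hdiag : ∀ k : ℕ, ∃ c : R, (Bm * Bp - Bp * Bm) ((Bp ^ k) Φ) = c • (Bp ^ k) Φ) (k : ℕ) :
    ∃ c : R, Bm ((Bp ^ (k + 1)) Φ) = c • (Bp ^ k) Φ := by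
  have step (j : ℕ) : ∃ c : R,
      Bm ((Bp ^ (j + 1)) Φ) = Bp (Bm ((Bp ^ j) Φ)) + c • (Bp ^ j) Φ := by
    obtain ⟨c, hc⟩ := hdiag j
    refine ⟨c, ?_⟩
    rw [← hc, pow_succ']
    simp
  induction k with
  | zero =>
    obtain ⟨c, hc⟩ := step 0
    exact ⟨c, by simpa [h0] using hc⟩
  | succ k ih =>
    obtain ⟨a, ha⟩ := ih
    obtain ⟨c, hc⟩ := step (k + 1)
    refine ⟨a + c, ?_⟩
    rw [hc, ha, map_smul, ← Module.End.mul_apply, ← pow_succ', add_smul]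

theorem trhpwn_number_vectors_orthogonal (V : Type*) [NormedAddCommGroup V]
    [InnerProductSpace ℂ V] (Φ : V)
    (n : ℕ) (hn : 1 ≤ n) (μ : ℝ) (hμ : 0 < μ)
    (Bp Bm N : Module.End ℂ V)
    (hadj : ∀ u v : V, (inner ℂ (Bp u) v : ℂ) = inner ℂ u (Bm v))
    (h0 : Bm Φ = 0)
    (hcomm : Bm * Bp - Bp * Bm = ((n : ℂ) ^ 2) • N)
    (hN : ∀ k : ℕ, N ((Bp ^ k) Φ) = ((μ / n + k * n * (n - 1) : ℝ) : ℂ) • (Bp ^ k) Φ) :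
    ∀ k m : ℕ, k ≠ m → (inner ℂ ((Bp ^ k) Φ) ((Bp ^ m) Φ) : ℂ) = 0 := by
  have lower := exists_annihilation_apply_pow_succ h0 fun k =>
    ⟨(n : ℂ) ^ 2 * ((μ / n + k * n * (n - 1) : ℝ) : ℂ), by
      rw [hcomm, LinearMap.smul_apply, hN, smul_smul]⟩
  have vacuum (k : ℕ) : inner ℂ ((Bp ^ (k + 1)) Φ) Φ = 0 := by
    rw [pow_succ', Module.End.mul_apply, hadj, h0, inner_zero_right]
  intro k
  induction k with
  | zero =>
    rintro (_ | m) hkm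
    · exact absurd rfl hkm
    · exact inner_eq_zero_symm.mp (vacuum m)
  | succ k ih =>
    rintro (_ | m) hkm
    · exact vacuum k
    · obtain ⟨c, hc⟩ := lower m
      rw [pow_succ' Bp k, Module.End.mul_apply, hadj, hc, inner_smul_right,
        ih m (fun h => hkm (congrArg Nat.succ h)), mul_zero]
end

section
/- Let n ≥ 2 be an integer, and set r := (1/n)·√(2/(n(n−1))). For simple (step) functions f, g : ℝ → ℂ vanishing outside a set of finite Lebesgue measure and satisfying |f(t)| < r and |g(t)| < r for all t, define K(f, g) := exp( −(2/(n²(n−1))) · ∫_ℝ log(1 − (n³(n−1)/2)·conj(f(t))·g(t)) dt ), where log is the principal branch of the complex logarithm. Then K is a positive semidefinite kernel: for any finitely many such functions f₁, …, f_m and complex numbers c₁, …, c_m, the sum ∑_{i,j=1}^m conj(c_i)·c_j·K(f_i, f_j) is a nonnegative real number. -/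
open MeasureTheory

open scoped ComplexOrder

namespace Matrix

variable {ι : Type*} [Fintype ι]

theorem PosSemidef.of_hasSum {A : ℕ → Matrix ι ι ℂ} {B : Matrix ι ι ℂ}
    (hA : ∀ k, (A k).PosSemidef) (hB : ∀ i j, HasSum (fun k ↦ A k i j) (B i j)) :
    B.PosSemidef := by
  refine PosSemidef.of_dotProduct_mulVec_nonneg ?_ fun x ↦ ?_
  · ext i j
    rw [conjTranspose_apply]
    refine (hB j i).star.unique ?_
    simpa only [(hA _).isHermitian.apply] using hB i j
  · have h : HasSum (fun k ↦ star x ⬝ᵥ (A k *ᵥ x)) (star x ⬝ᵥ (B *ᵥ x)) :=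
      hasSum_sum fun i _ ↦ (hasSum_sum fun j _ ↦ (hB i j).mul_right (x j)).mul_left (star x i)
    exact h.nonneg fun k ↦ (hA k).dotProduct_mulVec_nonneg x

theorem PosSemidef.integral {α : Type*} [MeasurableSpace α] {μ : Measure α}
    {A : α → Matrix ι ι ℂ} (hA : ∀ t, (A t).PosSemidef)
    (hint : ∀ i j, Integrable (fun t ↦ A t i j) μ) :
    (of fun i j ↦ ∫ t, A t i j ∂μ).PosSemidef := by
  refine PosSemidef.of_dotProduct_mulVec_nonneg ?_ fun x ↦ ?_
  · ext i j
    rw [conjTranspose_apply, of_apply, of_apply, ← starRingEnd_apply, ← integral_conj]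
    simp only [starRingEnd_apply, (hA _).isHermitian.apply]
  · have h : star x ⬝ᵥ ((of fun i j ↦ ∫ t, A t i j ∂μ) *ᵥ x) =
        ∫ t, star x ⬝ᵥ (A t *ᵥ x) ∂μ := by
      simp only [dotProduct, mulVec, of_apply]
      rw [integral_finsetSum _ fun i _ ↦
        (integrable_finsetSum _ fun j _ ↦ (hint i j).mul_const _).const_mul _]
      refine Finset.sum_congr rfl fun i _ ↦ ?_
      rw [integral_const_mul, integral_finsetSum _ fun j _ ↦ (hint i j).mul_const _]
      simp only [integral_mul_const]
    rw [h]
    exact integral_nonneg fun t ↦ (hA t).dotProduct_mulVec_nonneg x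

theorem PosSemidef.map_pow {A : Matrix ι ι ℂ} (hA : A.PosSemidef) (k : ℕ) :
    (A.map (· ^ k)).PosSemidef := by
  induction k with
  | zero =>
    convert posSemidef_vecMulVec_star_self (1 : ι → ℂ) using 1
    ext i j
    simp [vecMulVec_apply]
  | succ k ih =>
    have h : A.map (· ^ (k + 1)) = (A.map (· ^ k)).hadamard A := by
      ext i j
      simp [pow_succ]
    rw [h]
    exact ih.hadamard hA

theorem PosSemidef.map_exp {A : Matrix ι ι ℂ} (hA : A.PosSemidef) :
    (A.map Complex.exp).PosSemidef := by
  refine PosSemidef.of_hasSum (A := fun k ↦ ((k.factorial : ℂ)⁻¹) • A.map (· ^ k))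
    (fun k ↦ (hA.map_pow k).smul (by positivity)) fun i j ↦ ?_
  simpa [Complex.exp_eq_exp_ℂ, div_eq_inv_mul] using
    NormedSpace.expSeries_div_hasSum_exp (A i j)

theorem posSemidef_neg_log_one_sub {a : ℝ} (ha : 0 ≤ a) (z : ι → ℂ)
    (hz : ∀ i j, ‖(a : ℂ) * star (z i) * z j‖ < 1) :
    (of fun i j ↦ -Complex.log (1 - (a : ℂ) * star (z i) * z j)).PosSemidef := by
  refine PosSemidef.of_hasSum
    (A := fun k ↦ ((a : ℂ) ^ k / k) • vecMulVec (star fun i ↦ z i ^ k) fun i ↦ z i ^ k)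
    (fun k ↦ (posSemidef_vecMulVec_star_self _).smul (by positivity)) fun i j ↦ ?_
  rw [of_apply]
  convert Complex.hasSum_taylorSeries_neg_log (hz i j) using 2 with k
  simp [vecMulVec_apply, mul_pow]
  ring

end Matrix

theorem norm_mul_star_mul_lt_one {a r : ℝ} (ha : 0 ≤ a) (har : a * r ^ 2 = 1) {z w : ℂ}
    (hz : ‖z‖ < r) (hw : ‖w‖ < r) : ‖(a : ℂ) * star z * w‖ < 1 := by
  have ha' : 0 < a := ha.lt_of_ne (by rintro rfl; simp at har)
  rw [norm_mul, norm_mul, norm_star, Complex.norm_real, Real.norm_of_nonneg ha, ← har,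
    mul_assoc, sq]
  gcongr

theorem MeasureTheory.SimpleFunc.integrable_comp_pair {α E F G : Type*} [MeasurableSpace α]
    {μ : Measure α} [Zero E] [Zero F] [NormedAddCommGroup G] {f : SimpleFunc α E}
    {g : SimpleFunc α F} (hf : μ (Function.support f) < ⊤) (hg : μ (Function.support g) < ⊤)
    {φ : E → F → G} (hφ : φ 0 0 = 0) : Integrable (fun t ↦ φ (f t) (g t)) μ := by
  have hf' : f.FinMeasSupp μ := (SimpleFunc.finMeasSupp_iff_support).2 hf
  have hg' : g.FinMeasSupp μ := (SimpleFunc.finMeasSupp_iff_support).2 hg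
  exact (hf'.map₂ hg' (op := φ) hφ).integrable

theorem trhpwn_kernel_pos_semidef (n : ℕ) (hn : 2 ≤ n)
    (r : ℝ) (hr : r = 1 / n * Real.sqrt (2 / (n * (n - 1))))
    (m : ℕ) (f : Fin m → SimpleFunc ℝ ℂ)
    (hsupp : ∀ i, volume (Function.support (f i)) < ⊤)
    (hbound : ∀ i t, ‖f i t‖ < r)
    (c : Fin m → ℂ) :
    ∃ S : ℝ, 0 ≤ S ∧
      ∑ i, ∑ j, (starRingEnd ℂ) (c i) * c j *
        Complex.exp (-(2 / ((n : ℂ) ^ 2 * (n - 1))) *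
          ∫ t : ℝ, Complex.log
            (1 - (n : ℂ) ^ 3 * (n - 1) / 2 * (starRingEnd ℂ) (f i t) * f j t)) = S := by
  have hn' : (2 : ℝ) ≤ n := by exact_mod_cast hn
  have hn1 : (0 : ℝ) < n - 1 := by linarith
  obtain ⟨a, ha⟩ : ∃ a : ℝ, a = (n : ℝ) ^ 3 * (n - 1) / 2 := ⟨_, rfl⟩
  obtain ⟨b, hb⟩ : ∃ b : ℝ, b = 2 / ((n : ℝ) ^ 2 * (n - 1)) := ⟨_, rfl⟩
  have ha0 : 0 ≤ a := by rw [ha]; positivity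
  have hb0 : 0 ≤ b := by rw [hb]; positivity
  have har : a * r ^ 2 = 1 := by
    rw [ha, hr, mul_pow, Real.sq_sqrt (by positivity)]
    field_simp
  have haC : (n : ℂ) ^ 3 * (n - 1) / 2 = a := by rw [ha]; push_cast; rfl
  have hbC : 2 / ((n : ℂ) ^ 2 * (n - 1)) = b := by rw [hb]; push_cast; rfl
  have hM := (((Matrix.PosSemidef.integral (μ := volume)
    (fun t ↦ Matrix.posSemidef_neg_log_one_sub ha0 (fun i ↦ f i t) fun i j ↦
      norm_mul_star_mul_lt_one ha0 har (hbound i t) (hbound j t))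
    fun i j ↦ SimpleFunc.integrable_comp_pair (hsupp i) (hsupp j)
      (φ := fun z w ↦ -Complex.log (1 - (a : ℂ) * star z * w)) (by simp)).smul
      (Complex.zero_le_real.2 hb0)).map_exp).dotProduct_mulVec_nonneg c
  obtain ⟨S, hS, hSeq⟩ := RCLike.nonneg_iff_exists_ofReal.1 hM
  refine ⟨S, hS, Eq.trans ?_ hSeq.symm⟩
  simp only [dotProduct, Matrix.mulVec, Finset.mul_sum, haC, hbC]
  refine Finset.sum_congr rfl fun i _ ↦ Finset.sum_congr rfl fun j _ ↦ ?_
  simp [integral_neg]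
  ring
end
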